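/- arXiv:1710.09258 — 5 statements merged into one kernel-verified Lean document; each statement's English description precedes it below -/
import Mathlib

section
/- As p tends to infinity along prime numbers, the quadratic residue measures μ_p converge weakly to the uniform probability measure on the circle: for every continuous function g : ℝ/2πℤ → ℂ, (1/p)∑_{k=0}^{p-1} g(2πk²/p) tends to (1/2π)∫_0^{2π} g(θ) dθ as p → ∞ along primes. -/
open Filter Topology

/-- The quadratic exponential sum of a primitive additive character on a finite field of odd
characteristic has squared absolute value the cardinality of the field. -/
lemma AddChar.IsPrimitive.norm_sum_sq {F : Type*} [Field F] [Fintype F] {ψ : AddChar F ℂ}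
    (hψ : ψ.IsPrimitive) (h2 : (2 : F) ≠ 0) :
    ‖∑ x : F, ψ (x ^ 2)‖ ^ 2 = Fintype.card F := by
  classical
  have key : (∑ x : F, ψ (x ^ 2)) * (starRingEnd ℂ) (∑ x : F, ψ (x ^ 2)) = Fintype.card F := by
    calc (∑ x : F, ψ (x ^ 2)) * (starRingEnd ℂ) (∑ x : F, ψ (x ^ 2))
        = ∑ y : F, ∑ x : F, ψ (x ^ 2 - y ^ 2) := by
          rw [map_sum, Finset.sum_mul_sum, Finset.sum_comm]
          simp_rw [← AddChar.map_neg_eq_conj, ← AddChar.map_add_eq_mul, ← sub_eq_add_neg]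
      _ = ∑ y : F, ∑ d : F, ψ (d ^ 2) * ψ (y * (2 * d)) := by
          refine Finset.sum_congr rfl fun y _ ↦ ?_
          rw [← Equiv.sum_comp (Equiv.addRight y)]
          refine Finset.sum_congr rfl fun d _ ↦ ?_
          rw [← AddChar.map_add_eq_mul, Equiv.coe_addRight]
          congr 1
          ring
      _ = ∑ d : F, ψ (d ^ 2) * ∑ y : F, ψ (y * (2 * d)) := by
          rw [Finset.sum_comm]
          simp_rw [Finset.mul_sum]
      _ = Fintype.card F := by
          simp_rw [AddChar.sum_mulShift _ hψ]
          simp [h2]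
  rw [Complex.mul_conj, Complex.normSq_eq_norm_sq] at key
  exact_mod_cast key

lemma ZMod.sum_range_natCast {M : Type*} [AddCommMonoid M] (n : ℕ) [NeZero n] (f : ZMod n → M) :
    ∑ k ∈ Finset.range n, f k = ∑ x : ZMod n, f x :=
  Finset.sum_bij' (fun k _ ↦ (k : ZMod n)) (fun x _ ↦ x.val) (by simp)
    (fun x _ ↦ Finset.mem_range.2 x.val_lt)
    (fun k hk ↦ ZMod.val_cast_of_lt (Finset.mem_range.1 hk)) (by simp) (by simp)

/-- The average of a function on the circle of length `T` against the quadratic residue measure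
modulo `p`. -/
noncomputable def quadraticResidueAverage {T : ℝ} (p : ℕ) (f : AddCircle T → ℂ) : ℂ :=
  (p : ℂ)⁻¹ * ∑ k ∈ Finset.range p, f ((T * (k : ℝ) ^ 2 / p : ℝ) : AddCircle T)

section

variable {T : ℝ}

lemma norm_quadraticResidueAverage_sub_le [Fact (0 < T)] (p : ℕ) (f g : C(AddCircle T, ℂ)) :
    ‖quadraticResidueAverage p f - quadraticResidueAverage p g‖ ≤ ‖f - g‖ := by
  rw [quadraticResidueAverage, quadraticResidueAverage, ← mul_sub, ← Finset.sum_sub_distrib,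
    norm_mul, norm_inv, Complex.norm_natCast]
  rcases p.eq_zero_or_pos with rfl | hp
  · simp
  rw [inv_mul_le_iff₀ (by positivity)]
  refine (norm_sum_le_of_le _ fun k _ ↦ (f - g).norm_coe_le_norm _).trans ?_
  simp

lemma norm_quadraticResidueAverage_fourier (hT : T ≠ 0) {p : ℕ} (hp : p.Prime) (hp2 : p ≠ 2)
    {n : ℤ} (hn : ¬ (p : ℤ) ∣ n) :
    ‖quadraticResidueAverage p (fourier n : C(AddCircle T, ℂ))‖ = (√p)⁻¹ := by
  have := Fact.mk hp
  have hp0 : (p : ℝ) ≠ 0 := by exact_mod_cast hp.ne_zero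
  have hn' : (n : ZMod p) ≠ 0 := by rwa [Ne, ZMod.intCast_zmod_eq_zero_iff_dvd]
  have h2 : (2 : ZMod p) ≠ 0 := by
    intro h
    have : ((2 : ℕ) : ZMod p) = 0 := by exact_mod_cast h
    rw [ZMod.natCast_eq_zero_iff, Nat.prime_dvd_prime_iff_eq hp Nat.prime_two] at this
    exact hp2 this
  have hψ : (AddChar.mulShift (ZMod.stdAddChar (N := p)) (n : ZMod p)).IsPrimitive := by
    intro a ha
    rw [AddChar.mulShift_mulShift]
    exact ZMod.isPrimitive_stdAddChar p (mul_ne_zero hn' ha)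
  have hsum : ∑ k ∈ Finset.range p, fourier n ((T * (k : ℝ) ^ 2 / p : ℝ) : AddCircle T) =
      ∑ x : ZMod p, AddChar.mulShift (ZMod.stdAddChar (N := p)) (n : ZMod p) (x ^ 2) := by
    rw [← ZMod.sum_range_natCast]
    refine Finset.sum_congr rfl fun k _ ↦ ?_
    have hcast : (n : ZMod p) * (k : ZMod p) ^ 2 = ((n * (k : ℤ) ^ 2 : ℤ) : ZMod p) := by
      push_cast; rfl
    rw [AddChar.mulShift_apply, hcast, ZMod.stdAddChar_coe, fourier_coe_apply]
    congr 1
    have : (T : ℂ) ≠ 0 := by exact_mod_cast hT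
    push_cast
    field_simp
  have hnorm : ‖∑ x : ZMod p, AddChar.mulShift (ZMod.stdAddChar (N := p)) (n : ZMod p) (x ^ 2)‖ =
      √p := by
    rw [eq_comm, Real.sqrt_eq_iff_eq_sq (by positivity) (norm_nonneg _), hψ.norm_sum_sq h2,
      ZMod.card]
  rw [quadraticResidueAverage, hsum, norm_mul, hnorm, norm_inv, Complex.norm_natCast,
    inv_mul_eq_div, Real.sqrt_div_self]

lemma tendsto_quadraticResidueAverage_fourier [Fact (0 < T)] (n : ℤ) :
    Tendsto (fun p : ℕ ↦ quadraticResidueAverage p (fourier n : C(AddCircle T, ℂ)))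
      (atTop ⊓ 𝓟 {p : ℕ | p.Prime}) (𝓝 (fourierCoeff (fourier n : C(AddCircle T, ℂ)) 0)) := by
  have hT : (0 : ℝ) < T := Fact.out
  rw [fourierCoeff_fourier]
  rcases eq_or_ne n 0 with rfl | hn
  · rw [Pi.single_eq_same]
    refine tendsto_const_nhds.congr' ?_
    filter_upwards [mem_inf_of_right (mem_principal_self _)] with p (hp : p.Prime)
    have : (p : ℂ) ≠ 0 := by exact_mod_cast hp.ne_zero
    simp [quadraticResidueAverage, this]
  · rw [Pi.single_eq_of_ne hn.symm, tendsto_zero_iff_norm_tendsto_zero]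
    have hlim : Tendsto (fun p : ℕ ↦ (√p)⁻¹) (atTop ⊓ 𝓟 {p : ℕ | p.Prime}) (𝓝 0) :=
      (tendsto_inv_atTop_zero.comp
        (Real.tendsto_sqrt_atTop.comp tendsto_natCast_atTop_atTop)).mono_left inf_le_left
    refine hlim.congr' ?_
    filter_upwards [mem_inf_of_right (mem_principal_self _),
      mem_inf_of_left (eventually_gt_atTop (max 2 n.natAbs))] with p (hp : p.Prime) hlt
    have hlt' : 2 < p ∧ n.natAbs < p := max_lt_iff.1 hlt
    refine (norm_quadraticResidueAverage_fourier hT.ne' hp hlt'.1.ne' fun hdvd ↦ ?_).symm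
    exact hn (Int.eq_zero_of_dvd_of_natAbs_lt_natAbs hdvd (by simpa using hlt'.2))

lemma tendsto_quadraticResidueAverage [Fact (0 < T)] (f : C(AddCircle T, ℂ)) :
    Tendsto (fun p : ℕ ↦ quadraticResidueAverage p f)
      (atTop ⊓ 𝓟 {p : ℕ | p.Prime}) (𝓝 (fourierCoeff f 0)) := by
  have hequi : Equicontinuous fun (p : ℕ) (f : C(AddCircle T, ℂ)) ↦
      quadraticResidueAverage p f := by
    refine (LipschitzWith.uniformEquicontinuous _ 1 fun p ↦ ?_).equicontinuous
    refine LipschitzWith.of_dist_le_mul fun f g ↦ ?_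
    simpa [dist_eq_norm] using norm_quadraticResidueAverage_sub_le p f g
  have hcoeff (f : C(AddCircle T, ℂ)) : fourierCoeff f 0 = ∫ x, f x ∂AddCircle.haarAddCircle := by
    simp [fourierCoeff]
  have hint (f : C(AddCircle T, ℂ)) : MeasureTheory.Integrable f AddCircle.haarAddCircle :=
    f.continuous.integrable_of_hasCompactSupport (HasCompactSupport.of_compactSpace _)
  have hcont : Continuous fun f : C(AddCircle T, ℂ) ↦ fourierCoeff f 0 := by
    refine (LipschitzWith.of_dist_le_mul (K := 1) fun f g ↦ ?_).continuous
    rw [dist_eq_norm, dist_eq_norm, hcoeff, hcoeff, ← MeasureTheory.integral_sub (hint f) (hint g)]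
    refine (MeasureTheory.norm_integral_le_of_norm_le_const
      (.of_forall fun x ↦ (f - g).norm_coe_le_norm x)).trans ?_
    simp
  have hmem : f ∈ closure (Submodule.span ℂ (Set.range (@fourier T)) : Set C(AddCircle T, ℂ)) := by
    rw [← Submodule.topologicalClosure_coe, span_fourier_closure_eq_top]
    trivial
  refine (hequi f).tendsto_of_mem_closure hcont.continuousWithinAt (fun g hg ↦ ?_) hmem
  induction hg using Submodule.span_induction with
  | mem g hg =>
    obtain ⟨n, rfl⟩ := hg
    exact tendsto_quadraticResidueAverage_fourier n
  | zero => simpa [quadraticResidueAverage, fourierCoeff] using tendsto_const_nhds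
  | add g h _ _ hg hh =>
    have := hg.add hh
    rw [hcoeff, hcoeff, ← MeasureTheory.integral_add (hint g) (hint h)] at this
    rw [hcoeff]
    simpa [quadraticResidueAverage, Finset.sum_add_distrib, mul_add] using this
  | smul c g _ hg =>
    have := hg.const_mul c
    rw [hcoeff, ← MeasureTheory.integral_const_mul] at this
    rw [hcoeff]
    simpa [quadraticResidueAverage, ← Finset.mul_sum, mul_left_comm] using this

end


/-- As `p → ∞` along primes, the quadratic residue measures
`μ_p = (1/p) ∑_{k<p} δ_{2πk²/p}` converge weakly to the uniform probability measure on the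
circle: for every continuous `2π`-periodic function `g : ℝ → ℂ` (i.e. a continuous function
on `ℝ/2πℤ`), `(1/p) ∑_{k=0}^{p-1} g(2πk²/p) → (1/2π) ∫_0^{2π} g(θ) dθ`. -/
theorem stmt_2 (g : ℝ → ℂ) (hg : Continuous g) (hper : Function.Periodic g (2 * Real.pi)) :
    Filter.Tendsto
      (fun p : ℕ => (p : ℂ)⁻¹ * ∑ k ∈ Finset.range p, g (2 * Real.pi * (k : ℝ) ^ 2 / p))
      (Filter.atTop ⊓ Filter.principal {p : ℕ | p.Prime})
      (nhds ((2 * Real.pi : ℂ)⁻¹ * ∫ θ in (0:ℝ)..(2 * Real.pi), g θ)) := by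
  have : Fact (0 < 2 * Real.pi) := ⟨Real.two_pi_pos⟩
  let f : C(AddCircle (2 * Real.pi), ℂ) := ⟨hper.lift, hg.quotient_lift _⟩
  have hf (x : ℝ) : f x = g x := hper.lift_coe x
  have h := tendsto_quadraticResidueAverage f
  rw [fourierCoeff_eq_intervalIntegral _ 0 0] at h
  simpa [quadraticResidueAverage, hf, Complex.real_smul] using h
end

section
/- Let x, y : [a,b] → ℝ be C¹ functions with y'(t) ≠ 0 for all t ∈ [a,b]. Then (1/n) · #{t ∈ [a,b] : x(t) + n·y(t) ∈ 2πℤ} converges to |y(b) − y(a)|/(2π) as the integer n tends to infinity. -/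
/-- A continuous strictly increasing function on `[a, b]` takes values in `cℤ` about
`(f b - f a) / c` times. -/
theorem abs_ncard_preimage_zmultiples_sub_le {a b c : ℝ} (hab : a ≤ b) (hc : 0 < c) {f : ℝ → ℝ}
    (hf : ContinuousOn f (Set.Icc a b)) (hmono : StrictMonoOn f (Set.Icc a b)) :
    |({t ∈ Set.Icc a b | ∃ m : ℤ, f t = c * m}.ncard : ℝ) - (f b - f a) / c| ≤ 1 := by
  have hfab : f a ≤ f b :=
    hmono.monotoneOn (Set.left_mem_Icc.2 hab) (Set.right_mem_Icc.2 hab) hab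
  have himage : f '' {t ∈ Set.Icc a b | ∃ m : ℤ, f t = c * m} =
      (fun m : ℤ => c * (m : ℝ)) '' (Finset.Icc ⌈f a / c⌉ ⌊f b / c⌋ : Finset ℤ) := by
    ext z
    simp only [Set.mem_image, Set.mem_ofPred_eq, Finset.coe_Icc, Set.mem_Icc, Int.ceil_le,
      Int.le_floor, div_le_iff₀ hc, le_div_iff₀ hc]
    constructor
    · rintro ⟨t, ⟨ht, m, hm⟩, rfl⟩
      have h₁ := hmono.monotoneOn (Set.left_mem_Icc.2 hab) ht ht.1
      have h₂ := hmono.monotoneOn ht (Set.right_mem_Icc.2 hab) ht.2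
      exact ⟨m, ⟨by linarith, by linarith⟩, hm.symm⟩
    · rintro ⟨m, ⟨h₁, h₂⟩, rfl⟩
      obtain ⟨t, ht, hft⟩ := intermediate_value_Icc hab hf
        (show c * (m : ℝ) ∈ Set.Icc (f a) (f b) from ⟨by linarith, by linarith⟩)
      exact ⟨t, ⟨ht, m, hft⟩, hft⟩
  have hcard : {t ∈ Set.Icc a b | ∃ m : ℤ, f t = c * m}.ncard =
      (⌊f b / c⌋ + 1 - ⌈f a / c⌉).toNat := by
    rw [← Set.InjOn.ncard_image (hmono.injOn.mono fun t ht => ht.1), himage,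
      Set.ncard_image_of_injective, Set.ncard_coe_finset, Int.card_Icc]
    intro m k h
    exact_mod_cast mul_left_cancel₀ hc.ne' h
  have hle : f a / c ≤ f b / c := by gcongr
  have hceil : ⌈f a / c⌉ ≤ ⌊f b / c⌋ + 1 := by
    rw [Int.ceil_le]
    push_cast
    linarith [Int.lt_floor_add_one (f b / c)]
  have hcast : ((⌊f b / c⌋ + 1 - ⌈f a / c⌉).toNat : ℝ) =
      (⌊f b / c⌋ : ℝ) + 1 - (⌈f a / c⌉ : ℝ) := by
    have h := Int.toNat_of_nonneg (sub_nonneg.2 hceil)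
    exact_mod_cast congrArg (Int.cast : ℤ → ℝ) h
  rw [hcard, hcast, sub_div, abs_le]
  have h₁ := Int.lt_floor_add_one (f b / c)
  have h₂ := Int.floor_le (f b / c)
  have h₃ := Int.ceil_lt_add_one (f a / c)
  have h₄ := Int.le_ceil (f a / c)
  constructor <;> linarith

/-- If `y' > 0` on `[a, b]`, then `x + n y` is strictly increasing there for all large `n`. -/
theorem eventually_strictMonoOn_add_natCast_mul {a b : ℝ} {x y : ℝ → ℝ}
    (hx : ContDiff ℝ 1 x) (hy : ContDiff ℝ 1 y) (hy' : ∀ t ∈ Set.Icc a b, 0 < deriv y t) :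
    ∀ᶠ n : ℕ in Filter.atTop, StrictMonoOn (fun t => x t + n * y t) (Set.Icc a b) := by
  have hdx := hx.continuous_deriv_one
  have hdy := hy.continuous_deriv_one
  obtain ⟨M, hM⟩ := isCompact_Icc.exists_bound_of_continuousOn (s := Set.Icc a b)
    (f := fun t => deriv x t / deriv y t)
    (hdx.continuousOn.div hdy.continuousOn fun t ht => (hy' t ht).ne')
  filter_upwards [tendsto_natCast_atTop_atTop.eventually_gt_atTop M] with n hn
  refine strictMonoOn_of_deriv_pos (convex_Icc a b)
    (hx.continuous.add (continuous_const.mul hy.continuous)).continuousOn fun t ht => ?_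
  have ht' := interior_subset ht
  have hxt : HasDerivAt x (deriv x t) t := (hx.differentiable one_ne_zero t).hasDerivAt
  have hyt : HasDerivAt y (deriv y t) t := (hy.differentiable one_ne_zero t).hasDerivAt
  have hderiv := (hxt.add (hyt.const_mul (n : ℝ))).deriv
  have hquot : -(n : ℝ) < deriv x t / deriv y t := by
    have := (abs_le.1 (hM t ht')).1
    linarith
  rw [lt_div_iff₀ (hy' t ht')] at hquot
  calc (0 : ℝ) < deriv x t + n * deriv y t := by linarith
    _ = _ := hderiv.symm

theorem tendsto_ncard_div_of_deriv_pos {a b c : ℝ} (hab : a ≤ b) (hc : 0 < c) {x y : ℝ → ℝ}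
    (hx : ContDiff ℝ 1 x) (hy : ContDiff ℝ 1 y) (hy' : ∀ t ∈ Set.Icc a b, 0 < deriv y t) :
    Filter.Tendsto
      (fun n : ℕ => ({t ∈ Set.Icc a b | ∃ m : ℤ, x t + n * y t = c * m}.ncard : ℝ) / n)
      Filter.atTop (nhds (|y b - y a| / c)) := by
  have hmono := eventually_strictMonoOn_add_natCast_mul hx hy hy'
  have hyab : y a ≤ y b :=
    (strictMonoOn_of_deriv_pos (convex_Icc a b) hy.continuous.continuousOn
      fun t ht => hy' t (interior_subset ht)).monotoneOn
      (Set.left_mem_Icc.2 hab) (Set.right_mem_Icc.2 hab) hab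
  rw [abs_of_nonneg (sub_nonneg.2 hyab), tendsto_iff_dist_tendsto_zero]
  refine squeeze_zero' (Filter.Eventually.of_forall fun _ => dist_nonneg) ?_
    (tendsto_const_div_atTop_nhds_zero_nat (1 + |(x b - x a) / c|))
  filter_upwards [hmono, Filter.eventually_gt_atTop 0] with n hn hn0
  have hn0' : (0 : ℝ) < n := by exact_mod_cast hn0
  have h := abs_ncard_preimage_zmultiples_sub_le hab hc
    (f := fun t => x t + n * y t)
    (hx.continuous.add (continuous_const.mul hy.continuous)).continuousOn hn
  set N : ℝ := ({t ∈ Set.Icc a b | ∃ m : ℤ, x t + n * y t = c * m}.ncard : ℝ)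
  have hsplit : N / n - (y b - y a) / c =
      ((N - (x b + n * y b - (x a + n * y a)) / c) + (x b - x a) / c) / n := by
    field_simp
    ring
  rw [Real.dist_eq, hsplit, abs_div, abs_of_pos hn0']
  gcongr
  exact (abs_add_le _ _).trans (by gcongr)

/-- If `x, y : [a,b] → ℝ` are `C¹` and `y'` never vanishes on `[a,b]`, then
`(1/n) · #{t ∈ [a,b] : x(t) + n·y(t) ∈ 2πℤ} → |y(b) − y(a)|/(2π)` as `n → ∞`. -/
theorem stmt_5 (a b : ℝ) (hab : a ≤ b) (x y : ℝ → ℝ)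
    (hx : ContDiff ℝ 1 x) (hy : ContDiff ℝ 1 y)
    (hy' : ∀ t ∈ Set.Icc a b, deriv y t ≠ 0) :
    Filter.Tendsto
      (fun n : ℕ =>
        (({t ∈ Set.Icc a b | ∃ m : ℤ, x t + n * y t = 2 * Real.pi * m}.ncard : ℝ) / n))
      Filter.atTop (nhds (|y b - y a| / (2 * Real.pi))) := by
  have hsign := hasDerivWithinAt_forall_lt_or_forall_gt_of_forall_ne (convex_Icc a b)
    (fun t _ => (hy.differentiable one_ne_zero t).hasDerivAt.hasDerivWithinAt) hy'
  rcases hsign with hneg | hpos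
  · have h := tendsto_ncard_div_of_deriv_pos hab Real.two_pi_pos hx.neg hy.neg fun t ht => by
      rw [deriv.fun_neg]
      exact neg_pos.2 (hneg t ht)
    have hset : ∀ n : ℕ,
        {t ∈ Set.Icc a b | ∃ m : ℤ, -x t + n * -y t = 2 * Real.pi * m} =
          {t ∈ Set.Icc a b | ∃ m : ℤ, x t + n * y t = 2 * Real.pi * m} := by
      intro n
      ext t
      refine and_congr_right fun _ => (Equiv.neg ℤ).exists_congr fun m => ?_
      simp only [Equiv.neg_apply, Int.cast_neg]
      constructor <;> intro h <;> linarith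
    have habs : |-y b - -y a| = |y b - y a| := by
      rw [← abs_neg]
      ring_nf
    simpa only [hset, habs] using h
  · exact tendsto_ncard_div_of_deriv_pos hab Real.two_pi_pos hx hy hpos
end

section
/- Let A ∈ SL₂(ℤ) and let v ∈ ℚ² satisfy Av − v ∈ ℤ². Then for every u ∈ ℤ², det(v + u, A(v + u)) − det(v, Av) ∈ ℤ. Consequently the map f([v]) = det(v, Av) mod ℤ is a well-defined function from G_A = {v ∈ ℚ² : Av − v ∈ ℤ²}/ℤ² to ℚ/ℤ. -/
/-- The inclusion `ℤ² → ℚ²` as an additive group homomorphism. -/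
def castHom : (Fin 2 → ℤ) →+ (Fin 2 → ℚ) where
  toFun v := fun i => (v i : ℚ)
  map_zero' := by funext i; simp
  map_add' u v := by funext i; push_cast; simp

/-- The lattice `ℤ² ⊂ ℚ²`. -/
def intLat : AddSubgroup (Fin 2 → ℚ) := castHom.range

/-- The matrix `A` with entries read in `ℚ`. -/
def AQ (A : Matrix (Fin 2) (Fin 2) ℤ) : Matrix (Fin 2) (Fin 2) ℚ :=
  A.map (Int.cast : ℤ → ℚ)

/-- The subgroup `{v ∈ ℚ² : Av − v ∈ ℤ²}` of `ℚ²`: preimage of `ℤ²` under `v ↦ Av − v`. -/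
def FixSub (A : Matrix (Fin 2) (Fin 2) ℤ) : AddSubgroup (Fin 2 → ℚ) :=
  AddSubgroup.comap ((AQ A).mulVecLin - LinearMap.id).toAddMonoidHom intLat

/-- `G_A = {v ∈ ℚ² : Av − v ∈ ℤ²}/ℤ²`, as a subgroup of `ℚ²/ℤ²`. -/
def GA (A : Matrix (Fin 2) (Fin 2) ℤ) :
    AddSubgroup ((Fin 2 → ℚ) ⧸ intLat) :=
  (FixSub A).map (QuotientAddGroup.mk' intLat)

/-- `det(v, w) = v₀w₁ − v₁w₀` for `v, w ∈ ℚ²`. -/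
def det2 (v w : Fin 2 → ℚ) : ℚ := v 0 * w 1 - v 1 * w 0

/-- Translating a point of `FixSub A` by a lattice vector changes `det(w, Aw)` by an integer. -/
theorem exists_int_det2_add_castHom_sub {A : Matrix (Fin 2) (Fin 2) ℤ} (hdet : A.det = 1)
    {w : Fin 2 → ℚ} (hw : w ∈ FixSub A) (u : Fin 2 → ℤ) : ∃ z : ℤ,
      det2 (w + castHom u) ((AQ A).mulVec (w + castHom u)) - det2 w ((AQ A).mulVec w) = z := by
  obtain ⟨n, hn⟩ := hw
  have hn₀ : (A 0 0 : ℚ) * w 0 + A 0 1 * w 1 - w 0 = n 0 := by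
    simpa [castHom, AQ, Matrix.mulVec, dotProduct] using (congrFun hn 0).symm
  have hn₁ : (A 1 0 : ℚ) * w 0 + A 1 1 * w 1 - w 1 = n 1 := by
    simpa [castHom, AQ, Matrix.mulVec, dotProduct] using (congrFun hn 1).symm
  have hdetQ : (A 0 0 : ℚ) * A 1 1 - A 0 1 * A 1 0 = 1 := by
    rw [Matrix.det_fin_two] at hdet
    exact_mod_cast hdet
  refine ⟨-(n 0 * (A 1 0 * u 0 + A 1 1 * u 1) - n 1 * (A 0 0 * u 0 + A 0 1 * u 1))
    + (u 0 * n 1 - u 1 * n 0)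
    + (u 0 * (A 1 0 * u 0 + A 1 1 * u 1) - u 1 * (A 0 0 * u 0 + A 0 1 * u 1)), ?_⟩
  simp only [det2, castHom, AQ, Matrix.mulVec, dotProduct, Fin.sum_univ_two, Matrix.map_apply,
    Pi.add_apply, AddMonoidHom.coe_mk, ZeroHom.coe_mk]
  push_cast
  linear_combination (w 0 * u 1 - w 1 * u 0) * hdetQ
    - (A 1 0 * u 0 + A 1 1 * u 1 + u 1) * hn₀ + (A 0 0 * u 0 + A 0 1 * u 1 + u 0) * hn₁

/-- For `A ∈ SL₂(ℤ)` and `v ∈ ℚ²` with `Av − v ∈ ℤ²`, for every `u ∈ ℤ²` one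
has `det(v + u, A(v + u)) − det(v, Av) ∈ ℤ`; consequently `[v] ↦ det(v, Av) mod ℤ` is a
well-defined function `G_A → ℚ/ℤ` (any two representatives of a class of `G_A` give values
differing by an integer). -/
theorem stmt_9 (A : Matrix (Fin 2) (Fin 2) ℤ) (hdet : A.det = 1)
    (v : Fin 2 → ℚ) (hv : v ∈ FixSub A) :
    (∀ u : Fin 2 → ℤ, ∃ z : ℤ,
      det2 (v + castHom u) ((AQ A).mulVec (v + castHom u)) - det2 v ((AQ A).mulVec v) = z) ∧
    (∀ w : Fin 2 → ℚ, w ∈ FixSub A → v - w ∈ intLat →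
      ∃ z : ℤ, det2 v ((AQ A).mulVec v) - det2 w ((AQ A).mulVec w) = z) := by
  refine ⟨exists_int_det2_add_castHom_sub hdet hv, fun w hw ⟨u, hu⟩ => ?_⟩
  have hvw : v = w + castHom u := by rw [hu]; abel
  rw [hvw]
  exact exists_int_det2_add_castHom_sub hdet hw u
end

section
/- Let A ∈ SL₂(ℤ) and let v, w ∈ ℚ² satisfy Av − v ∈ ℤ² and Aw − w ∈ ℤ². Then det(v, (A − A^{-1})w) − 2·det(v, (A − I)w) ∈ ℤ, i.e. the bilinear form b(v, w) = det(v, (A − A^{-1})w) satisfies b(v, w) ≡ 2·det(v, (A − I)w) mod ℤ on fixed points. -/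
theorem det2_mulVec_mulVec (M : Matrix (Fin 2) (Fin 2) ℚ) (v w : Fin 2 → ℚ) :
    det2 (M.mulVec v) (M.mulVec w) = M.det * det2 v w := by
  simp only [det2, Matrix.mulVec, dotProduct, Fin.sum_univ_two, Matrix.det_fin_two]
  ring

theorem det_AQ (A : Matrix (Fin 2) (Fin 2) ℤ) : (AQ A).det = A.det :=
  ((Int.castRingHom ℚ).map_det A).symm

theorem exists_mulVec_of_mem_FixSub {A : Matrix (Fin 2) (Fin 2) ℤ} {v : Fin 2 → ℚ}
    (hv : v ∈ FixSub A) : ∃ m : Fin 2 → ℤ, (AQ A - 1).mulVec v = castHom m := by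
  obtain ⟨m, hm⟩ := hv
  refine ⟨m, ?_⟩
  rw [hm, Matrix.sub_mulVec, Matrix.one_mulVec]
  rfl

/-- For `M` of determinant one, `2 - M - M⁻¹` is the scalar `det (M - 1)`. -/
theorem det2_sub_inv_mulVec {M : Matrix (Fin 2) (Fin 2) ℚ} (hM : M.det = 1)
    (v w : Fin 2 → ℚ) :
    det2 v ((M - M⁻¹).mulVec w) - 2 * det2 v ((M - 1).mulVec w) =
      (M - 1).det * det2 v w := by
  rw [Matrix.inv_def, hM, Ring.inverse_one, one_smul, Matrix.adjugate_fin_two]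
  rw [Matrix.det_fin_two] at hM
  simp [det2, Matrix.mulVec, dotProduct, Fin.sum_univ_two, Matrix.det_fin_two]
  linear_combination -(v 0 * w 1 - v 1 * w 0) * hM

/-- For `A ∈ SL₂(ℤ)` and `v, w ∈ ℚ²` with `Av − v ∈ ℤ²` and `Aw − w ∈ ℤ²`,
`det(v, (A − A⁻¹)w) − 2·det(v, (A − I)w) ∈ ℤ`, i.e. the bilinear form
`b(v, w) = det(v, (A − A⁻¹)w)` satisfies `b(v, w) ≡ 2 det(v, (A − I)w) mod ℤ` on fixed
points. -/
theorem stmt_11 (A : Matrix (Fin 2) (Fin 2) ℤ) (hdet : A.det = 1)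
    (v w : Fin 2 → ℚ) (hv : v ∈ FixSub A) (hw : w ∈ FixSub A) :
    ∃ z : ℤ,
      det2 v ((AQ A - (AQ A)⁻¹).mulVec w) - 2 * det2 v ((AQ A - 1).mulVec w) = z := by
  obtain ⟨m, hm⟩ := exists_mulVec_of_mem_FixSub hv
  obtain ⟨n, hn⟩ := exists_mulVec_of_mem_FixSub hw
  refine ⟨m 0 * n 1 - m 1 * n 0, ?_⟩
  rw [det2_sub_inv_mulVec (by rw [det_AQ, hdet, Int.cast_one]), ← det2_mulVec_mulVec, hm, hn]
  simp [det2, castHom]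
end

section
/- Let A ∈ SL₂(ℤ) with tr(A) ≠ 2 and let ℓ be an integer with gcd(2ℓ, 2 − tr(A)) = 1. Let v ∈ ℚ² with Av − v ∈ ℤ². If ℓ·det(v, (A − A^{-1})w) ∈ ℤ for every w ∈ ℚ² with Aw − w ∈ ℤ², then v ∈ ℤ². In other words, the bilinear pairing (v, w) ↦ ℓ·det(v, (A − A^{-1})w) mod ℤ is nondegenerate on G_A = {v ∈ ℚ² : Av − v ∈ ℤ²}/ℤ². -/
theorem mem_intLat_iff {v : Fin 2 → ℚ} :
    v ∈ intLat ↔ ∃ m n : ℤ, v 0 = m ∧ v 1 = n := by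
  constructor
  · rintro ⟨u, rfl⟩
    exact ⟨u 0, u 1, rfl, rfl⟩
  · rintro ⟨m, n, hm, hn⟩
    refine ⟨![m, n], ?_⟩
    funext i
    fin_cases i <;> simp [castHom, hm, hn]

theorem mem_FixSub_iff {A : Matrix (Fin 2) (Fin 2) ℤ} {v : Fin 2 → ℚ} :
    v ∈ FixSub A ↔ ∃ m n : ℤ,
      (A 0 0 : ℚ) * v 0 + A 0 1 * v 1 - v 0 = m ∧ (A 1 0 : ℚ) * v 0 + A 1 1 * v 1 - v 1 = n := by
  rw [FixSub, AddSubgroup.mem_comap, mem_intLat_iff]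
  simp [AQ]

theorem AQ_sub_inv {A : Matrix (Fin 2) (Fin 2) ℤ} (hdet : A.det = 1) :
    AQ A - (AQ A)⁻¹ =
      !![(A 0 0 : ℚ) - A 1 1, 2 * (A 0 1 : ℚ); 2 * (A 1 0 : ℚ), (A 1 1 : ℚ) - A 0 0] := by
  have hd : (AQ A).det = 1 := by
    rw [Matrix.det_fin_two] at hdet ⊢
    simp only [AQ, Matrix.map_apply]
    exact_mod_cast hdet
  rw [Matrix.inv_def, hd, Matrix.adjugate_fin_two]
  ext i j
  fin_cases i <;> fin_cases j <;> simp [AQ] <;> ring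

/-- A rational number with two coprime integer multiples that are integers is an integer. -/
theorem exists_int_eq_of_gcd_eq_one {p q : ℤ} (h : Int.gcd p q = 1) {x : ℚ}
    (hp : ∃ m : ℤ, p * x = m) (hq : ∃ n : ℤ, q * x = n) : ∃ k : ℤ, x = k := by
  obtain ⟨m, hm⟩ := hp
  obtain ⟨n, hn⟩ := hq
  obtain ⟨r, s, hrs⟩ := Int.isCoprime_iff_gcd_eq_one.mpr h
  have hrs' : (r : ℚ) * p + s * q = 1 := by exact_mod_cast hrs
  refine ⟨r * m + s * n, ?_⟩
  push_cast
  linear_combination -x * hrs' + r * hm + s * hn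

/-- Let `A ∈ SL₂(ℤ)` with `tr(A) ≠ 2` and `ℓ ∈ ℤ` with
`gcd(2ℓ, 2 − tr A) = 1`. If `v ∈ ℚ²` satisfies `Av − v ∈ ℤ²` and
`ℓ·det(v, (A − A⁻¹)w) ∈ ℤ` for every `w ∈ ℚ²` with `Aw − w ∈ ℤ²`, then `v ∈ ℤ²`:
the pairing `(v, w) ↦ ℓ·det(v, (A − A⁻¹)w) mod ℤ` is nondegenerate on
`G_A = {v ∈ ℚ² : Av − v ∈ ℤ²}/ℤ²`. -/
theorem stmt_12 (A : Matrix (Fin 2) (Fin 2) ℤ) (hdet : A.det = 1) (htr : A.trace ≠ 2)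
    (ℓ : ℤ) (hg : Int.gcd (2 * ℓ) (2 - A.trace) = 1)
    (v : Fin 2 → ℚ) (hv : v ∈ FixSub A)
    (hpair : ∀ w : Fin 2 → ℚ, w ∈ FixSub A →
      ∃ z : ℤ, (ℓ : ℚ) * det2 v ((AQ A - (AQ A)⁻¹).mulVec w) = z) :
    v ∈ intLat := by
  have hdet' := hdet
  rw [Matrix.det_fin_two] at hdet'
  rw [Matrix.trace_fin_two] at htr hg
  rw [AQ_sub_inv hdet] at hpair
  obtain ⟨m, n, hm, hn⟩ := mem_FixSub_iff.mp hv
  have hd : (A 0 0 : ℚ) * A 1 1 - A 0 1 * A 1 0 = 1 := by exact_mod_cast hdet'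
  have ht : (2 - (A 0 0 + A 1 1) : ℚ) ≠ 0 := by
    rw [sub_ne_zero]
    exact_mod_cast htr.symm
  obtain ⟨y, hy⟩ := hpair
    ![(A 1 1 - 1) / (2 - (A 0 0 + A 1 1)), -A 1 0 / (2 - (A 0 0 + A 1 1))] <| by
      refine mem_FixSub_iff.mpr ⟨1, 0, ?_, ?_⟩ <;> simp <;> field_simp
      · linear_combination hd
      · ring
  obtain ⟨z, hz⟩ := hpair
    ![-A 0 1 / (2 - (A 0 0 + A 1 1)), (A 0 0 - 1) / (2 - (A 0 0 + A 1 1))] <| by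
      refine mem_FixSub_iff.mpr ⟨0, 1, ?_, ?_⟩ <;> simp <;> field_simp
      · ring
      · linear_combination hd
  have hy' : (ℓ : ℚ) * (-A 1 0 * v 0 - (1 + A 1 1) * v 1) = y := by
    rw [← hy]
    simp [det2, Matrix.mulVec, dotProduct, Fin.sum_univ_two]
    field_simp
    left
    linear_combination 2 * v 1 * hd
  have hz' : (ℓ : ℚ) * ((1 + A 0 0) * v 0 + A 0 1 * v 1) = z := by
    rw [← hz]
    simp [det2, Matrix.mulVec, dotProduct, Fin.sum_univ_two]
    field_simp
    left
    linear_combination -2 * v 0 * hd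
  obtain ⟨k₀, h₀⟩ : ∃ k : ℤ, v 0 = k := by
    refine exists_int_eq_of_gcd_eq_one hg ⟨z - ℓ * m, ?_⟩ ⟨(A 1 1 - 1) * m - A 0 1 * n, ?_⟩ <;>
      push_cast
    · linear_combination hz' - ℓ * hm
    · linear_combination (A 1 1 - 1 : ℚ) * hm - A 0 1 * hn - v 0 * hd
  obtain ⟨k₁, h₁⟩ : ∃ k : ℤ, v 1 = k := by
    refine exists_int_eq_of_gcd_eq_one hg ⟨-y - ℓ * n, ?_⟩ ⟨(A 0 0 - 1) * n - A 1 0 * m, ?_⟩ <;>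
      push_cast
    · linear_combination -hy' - ℓ * hn
    · linear_combination (A 0 0 - 1 : ℚ) * hn - A 1 0 * hm - v 1 * hd
  exact mem_intLat_iff.mpr ⟨k₀, k₁, h₀, h₁⟩
end
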